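/- arXiv:2305.17867 — 2 statements merged into one kernel-verified Lean document; each statement's English description precedes it below -/
import Mathlib

section
/- If v ∈ ℂ^{N(p)} satisfies P v = 0, then the entries of v indexed by j̄ are determined by the entries indexed by j via v_{j̄} = −(P_{[:,j̄]})⁻¹ P_{[:,j]} v_j; equivalently, v = M v_j where M is the decompression matrix. -/
open scoped BigOperators

def Mfin (d t : ℕ) : Finset (Fin d → ℕ) :=
  (Fintype.piFinset fun _ : Fin d => Finset.range (t + 1)).filter fun q => ∑ i, q i ≤ t

def Nc (d t : ℕ) : ℕ := (Mfin d t).card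

structure GradedOrdering (d : ℕ) where
  toEquiv : ℕ+ ≃ (Fin d → ℕ)
  map_one : toEquiv 1 = 0
  graded : ∀ i j : ℕ+, (∑ k, toEquiv i k) < (∑ k, toEquiv j k) → i < j
  compat : ∀ i j k : ℕ+, i < j →
    toEquiv.symm (toEquiv i + toEquiv k) < toEquiv.symm (toEquiv j + toEquiv k)

open Classical in
noncomputable def bcoef {d : ℕ} (a : (Fin d → ℕ) → ℂ) (c : ℕ) (n m : Fin d → ℕ) : ℂ :=
  if n ≤ m ∧ m - n ∈ Mfin d c then a (m - n) else 0

noncomputable def hIdx {d : ℕ} (a : (Fin d → ℕ) → ℂ) (c p : ℕ) (ν : GradedOrdering d)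
    (i : ℕ+) : ℕ+ :=
  (sSup {l : ℕ | 0 < l ∧ l ≤ Nc d p ∧
    bcoef a c (ν.toEquiv i) (ν.toEquiv l.toPNat') ≠ 0}).toPNat'

def barSet {d : ℕ} (a : (Fin d → ℕ) → ℂ) (c p : ℕ) (ν : GradedOrdering d) : Set ℕ+ :=
  {l | ∃ i : ℕ+, (i : ℕ) ≤ Nc d (p - c) ∧ hIdx a c p ν i = l}

open Classical in
noncomputable def Jfin {d : ℕ} (a : (Fin d → ℕ) → ℂ) (c p : ℕ) (ν : GradedOrdering d) :
    Finset ℕ+ :=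
  ((Finset.range (Nc d p)).filter fun l => l.succPNat ∉ barSet a c p ν).image Nat.succPNat

noncomputable def Pbar {d : ℕ} (a : (Fin d → ℕ) → ℂ) (c p : ℕ) (ν : GradedOrdering d) :
    Matrix (Fin (Nc d (p - c))) (Fin (Nc d (p - c))) ℂ :=
  Matrix.of fun i j =>
    bcoef a c (ν.toEquiv i.val.succPNat) (ν.toEquiv (hIdx a c p ν j.val.succPNat))

open Classical in
noncomputable def Mdec {d : ℕ} (a : (Fin d → ℕ) → ℂ) (c p : ℕ) (ν : GradedOrdering d)
    (i s : ℕ+) : ℂ :=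
  if hr : ∃ r : Fin (Nc d (p - c)), hIdx a c p ν r.val.succPNat = i then
    -∑ r₂ : Fin (Nc d (p - c)), (Pbar a c p ν)⁻¹ hr.choose r₂ *
      bcoef a c (ν.toEquiv r₂.val.succPNat) (ν.toEquiv s)
  else if i = s then (1 : ℂ) else 0

noncomputable def pderiv' {d : ℕ} (i : Fin d) (f : (Fin d → ℝ) → ℂ) : (Fin d → ℝ) → ℂ :=
  fun x => fderiv ℝ f x (Pi.single i 1)

noncomputable def mderiv {d : ℕ} (m : Fin d → ℕ) (f : (Fin d → ℝ) → ℂ) :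
    (Fin d → ℝ) → ℂ :=
  (List.finRange d).foldr (fun i g => (pderiv' i)^[m i] g) f

open Classical in
noncomputable def Tmat {d : ℕ} (ν : GradedOrdering d) (hv : Fin d → ℝ) (n i : ℕ+) : ℂ :=
  if ν.toEquiv i ≤ ν.toEquiv n then
    ∏ k, (((hv k : ℝ) : ℂ) ^ ((ν.toEquiv n - ν.toEquiv i) k) /
      (((ν.toEquiv n - ν.toEquiv i) k).factorial : ℂ))
  else 0

noncomputable def alphaVec {d : ℕ} (ν : GradedOrdering d) (y c₁ : Fin d → ℝ) (n : ℕ+) : ℂ :=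
  ∏ k, (((c₁ k - y k : ℝ) : ℂ) ^ (ν.toEquiv n k) / ((ν.toEquiv n k).factorial : ℂ))

theorem mem_Mfin {d t : ℕ} {q : Fin d → ℕ} : q ∈ Mfin d t ↔ ∑ i, q i ≤ t := by
  simp only [Mfin, Finset.mem_filter, Fintype.mem_piFinset, Finset.mem_range,
    and_iff_right_iff_imp]
  intro h i
  have := Finset.single_le_sum (f := q) (fun _ _ => Nat.zero_le _) (Finset.mem_univ i)
  omega

/-- A finite initial segment of `ℕ+` is `{1, …, #S}`. -/
theorem PNat.mem_iff_le_card_of_isLowerSet {S : Finset ℕ+} (hS : IsLowerSet (S : Set ℕ+))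
    (i : ℕ+) : i ∈ S ↔ (i : ℕ) ≤ S.card := by
  constructor
  · intro hi
    have hsub : Finset.Icc 1 i ⊆ S := fun x hx => hS (Finset.mem_Icc.1 hx).2 hi
    simpa using Finset.card_le_card hsub
  · intro hi
    by_contra hn
    have hsub : S ⊆ Finset.Ico 1 i := fun x hx =>
      Finset.mem_Ico.2 ⟨one_le, lt_of_not_ge fun h => hn (hS h hx)⟩
    have hcard := Finset.card_le_card hsub
    have hpos := i.pos
    simp only [PNat.card_Ico, PNat.one_coe] at hcard
    omega

/-- The ordering enumerates the multi-indices of degree at most `t` by `1, …, N(t)`. -/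
theorem GradedOrdering.le_Nc_iff {d : ℕ} (ν : GradedOrdering d) (t : ℕ) (i : ℕ+) :
    (i : ℕ) ≤ Nc d t ↔ ∑ k, ν.toEquiv i k ≤ t := by
  have hS : IsLowerSet (((Mfin d t).map ν.toEquiv.symm.toEmbedding : Finset ℕ+) : Set ℕ+) := by
    intro x y hyx hx
    simp only [Finset.mem_coe, Finset.mem_map_equiv, Equiv.symm_symm, mem_Mfin] at hx ⊢
    by_contra! h
    exact absurd (ν.graded x y (hx.trans_lt h)) (not_lt.2 hyx)
  have h := PNat.mem_iff_le_card_of_isLowerSet hS i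
  rw [Finset.card_map, Finset.mem_map_equiv, Equiv.symm_symm, mem_Mfin] at h
  exact h.symm

theorem GradedOrdering.strictMono_add {d : ℕ} (ν : GradedOrdering d) (m : Fin d → ℕ) :
    StrictMono fun i : ℕ+ => ν.toEquiv.symm (ν.toEquiv i + m) := by
  intro i j hij
  simpa using ν.compat i j (ν.toEquiv.symm m) hij

theorem GradedOrdering.symm_add_le {d : ℕ} (ν : GradedOrdering d) (n : Fin d → ℕ)
    {m m₁ : Fin d → ℕ} (h : ν.toEquiv.symm m ≤ ν.toEquiv.symm m₁) :
    ν.toEquiv.symm (n + m) ≤ ν.toEquiv.symm (n + m₁) := by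
  simpa [add_comm] using (ν.strictMono_add n).monotone h

/-- `m₀` is the last multi-index of degree at most `c` with nonzero coefficient. -/
structure IsLeadingIndex {d : ℕ} (a : (Fin d → ℕ) → ℂ) (c : ℕ) (ν : GradedOrdering d)
    (m₀ : Fin d → ℕ) : Prop where
  mem : m₀ ∈ Mfin d c
  ne_zero : a m₀ ≠ 0
  le : ∀ m ∈ Mfin d c, a m ≠ 0 → ν.toEquiv.symm m ≤ ν.toEquiv.symm m₀

theorem exists_isLeadingIndex {d c : ℕ} {a : (Fin d → ℕ) → ℂ} (ν : GradedOrdering d)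
    (ha : ∃ m ∈ Mfin d c, a m ≠ 0) : ∃ m₀, IsLeadingIndex a c ν m₀ := by
  classical
  obtain ⟨m, hm, ham⟩ := ha
  obtain ⟨m₀, hm₀, hmax⟩ := ((Mfin d c).filter (a · ≠ 0)).exists_max_image ν.toEquiv.symm
    ⟨m, Finset.mem_filter.2 ⟨hm, ham⟩⟩
  rw [Finset.mem_filter] at hm₀
  exact ⟨m₀, hm₀.1, hm₀.2, fun m hm ham => hmax m (Finset.mem_filter.2 ⟨hm, ham⟩)⟩

namespace IsLeadingIndex

variable {d c p : ℕ} {a : (Fin d → ℕ) → ℂ} {ν : GradedOrdering d} {m₀ : Fin d → ℕ}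

theorem bcoef_add (h : IsLeadingIndex a c ν m₀) (n : Fin d → ℕ) :
    bcoef a c n (n + m₀) = a m₀ := by
  simp [bcoef, h.mem]

theorem le_of_bcoef_ne_zero (h : IsLeadingIndex a c ν m₀) {n m : Fin d → ℕ}
    (hb : bcoef a c n m ≠ 0) : ν.toEquiv.symm m ≤ ν.toEquiv.symm (n + m₀) := by
  unfold bcoef at hb
  split_ifs at hb with hnm
  · simpa [add_tsub_cancel_of_le hnm.1] using ν.symm_add_le n (h.le _ hnm.2 hb)
  · exact absurd rfl hb

theorem symm_add_le_Nc (h : IsLeadingIndex a c ν m₀) (hpc : c ≤ p) {i : ℕ+}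
    (hi : (i : ℕ) ≤ Nc d (p - c)) : (ν.toEquiv.symm (ν.toEquiv i + m₀) : ℕ) ≤ Nc d p := by
  have hm := mem_Mfin.1 h.mem
  rw [ν.le_Nc_iff] at hi ⊢
  simp only [Equiv.apply_symm_apply, Pi.add_apply, Finset.sum_add_distrib]
  omega

theorem hIdx_eq (h : IsLeadingIndex a c ν m₀) (hpc : c ≤ p) {i : ℕ+}
    (hi : (i : ℕ) ≤ Nc d (p - c)) : hIdx a c p ν i = ν.toEquiv.symm (ν.toEquiv i + m₀) := by
  have hgreatest : IsGreatest {l : ℕ | 0 < l ∧ l ≤ Nc d p ∧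
      bcoef a c (ν.toEquiv i) (ν.toEquiv l.toPNat') ≠ 0}
      (ν.toEquiv.symm (ν.toEquiv i + m₀) : ℕ) := by
    refine ⟨⟨PNat.pos _, h.symm_add_le_Nc hpc hi, ?_⟩, ?_⟩
    · rw [PNat.coe_toPNat', Equiv.apply_symm_apply, h.bcoef_add]
      exact h.ne_zero
    · rintro l ⟨hl, -, hb⟩
      have hle := h.le_of_bcoef_ne_zero hb
      rw [Equiv.symm_apply_apply, ← PNat.coe_le_coe, PNat.toPNat'_coe hl] at hle
      exact hle
  rw [hIdx, hgreatest.csSup_eq, PNat.coe_toPNat']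

theorem hIdx_fin (h : IsLeadingIndex a c ν m₀) (hpc : c ≤ p) (r : Fin (Nc d (p - c))) :
    hIdx a c p ν r.val.succPNat = ν.toEquiv.symm (ν.toEquiv r.val.succPNat + m₀) :=
  h.hIdx_eq hpc (by simp only [Nat.succPNat_coe]; exact r.isLt)

theorem hIdx_injective (h : IsLeadingIndex a c ν m₀) (hpc : c ≤ p) :
    Function.Injective fun r : Fin (Nc d (p - c)) => hIdx a c p ν r.val.succPNat := by
  intro r s hrs
  simp only [h.hIdx_fin hpc] at hrs
  exact Fin.ext (Nat.succPNat_injective ((ν.strictMono_add m₀).injective hrs))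

theorem isUnit_det_Pbar (h : IsLeadingIndex a c ν m₀) (hpc : c ≤ p) :
    IsUnit (Pbar a c p ν).det := by
  have htri : (Pbar a c p ν).BlockTriangular OrderDual.toDual := by
    intro i j hij
    by_contra hb
    rw [Pbar, Matrix.of_apply, h.hIdx_fin hpc, Equiv.apply_symm_apply] at hb
    have hle := (ν.strictMono_add m₀).le_iff_le.1 (h.le_of_bcoef_ne_zero hb)
    exact absurd (Nat.succPNat_le_succPNat.1 hle) (not_le.2 hij)
  rw [Matrix.det_of_isLowerTriangular _ htri]
  simp [Pbar, h.hIdx_fin hpc, h.bcoef_add, h.ne_zero]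

/-- Summation over all column indices splits into the columns `j` and the columns `j̄`. -/
theorem sum_range_Nc (h : IsLeadingIndex a c ν m₀) (hpc : c ≤ p) (f : ℕ+ → ℂ) :
    ∑ l ∈ Finset.range (Nc d p), f l.succPNat =
      ∑ s ∈ Jfin a c p ν, f s +
        ∑ r : Fin (Nc d (p - c)), f (hIdx a c p ν r.val.succPNat) := by
  classical
  rw [Jfin, Finset.sum_image Nat.succPNat_injective.injOn,
    ← Finset.sum_filter_not_add_sum_filter (Finset.range (Nc d p))
      (fun l => l.succPNat ∈ barSet a c p ν)]
  congr 1
  symm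
  refine Finset.sum_bij (fun r _ => (hIdx a c p ν r.val.succPNat).natPred) ?_ ?_ ?_ ?_
  · intro r _
    have hr : (r.val.succPNat : ℕ) ≤ Nc d (p - c) := by
      rw [Nat.succPNat_coe]; exact r.isLt
    have hle := h.symm_add_le_Nc hpc hr
    rw [← h.hIdx_eq hpc hr] at hle
    simp only [Finset.mem_filter, Finset.mem_range, PNat.succPNat_natPred]
    refine ⟨?_, _, hr, rfl⟩
    have := PNat.natPred_add_one (hIdx a c p ν r.val.succPNat)
    omega
  · intro r _ s _ hrs
    exact h.hIdx_injective hpc (PNat.natPred_injective hrs)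
  · intro l hl
    obtain ⟨i, hi, hil⟩ := (Finset.mem_filter.1 hl).2
    have hpred := PNat.natPred_add_one i
    refine ⟨⟨i.natPred, by omega⟩, Finset.mem_univ _, ?_⟩
    simp [PNat.succPNat_natPred, hil]
  · intro r _
    rw [PNat.succPNat_natPred]

end IsLeadingIndex

/-- If `v ∈ ℂ^{N(p)}` satisfies `P v = 0`, then the entries of `v`
indexed by `j̄ = (h(1),…,h(N(p−c)))` are determined by the entries indexed by the
represented indices `j` via `v_{j̄} = −(P_{[:,j̄]})⁻¹ P_{[:,j]} v_j`; equivalently,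
`v = M v_j` where `M` is the decompression matrix. -/
theorem decompression {d p c : ℕ} (hd : 1 ≤ d) (hc : 1 ≤ c) (hpc : c ≤ p)
    (ν : GradedOrdering d) (a : (Fin d → ℕ) → ℂ)
    (ha : ∃ m ∈ Mfin d c, (∑ i, m i) = c ∧ a m ≠ 0)
    (v : ℕ+ → ℂ)
    (hv : ∀ i : ℕ+, (i : ℕ) ≤ Nc d (p - c) →
      ∑ l ∈ Finset.range (Nc d p),
        bcoef a c (ν.toEquiv i) (ν.toEquiv l.succPNat) * v l.succPNat = 0) :
    (∀ r : Fin (Nc d (p - c)),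
      v (hIdx a c p ν r.val.succPNat) =
        -∑ r₂ : Fin (Nc d (p - c)), (Pbar a c p ν)⁻¹ r r₂ *
          ∑ s ∈ Jfin a c p ν, bcoef a c (ν.toEquiv r₂.val.succPNat) (ν.toEquiv s) * v s)
    ∧ (∀ i : ℕ+, (i : ℕ) ≤ Nc d p →
        v i = ∑ s ∈ Jfin a c p ν, Mdec a c p ν i s * v s) := by
  obtain ⟨m, hm, -, ham⟩ := ha
  obtain ⟨m₀, h⟩ := exists_isLeadingIndex ν ⟨m, hm, ham⟩
  have hbar : ∀ r : Fin (Nc d (p - c)),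
      v (hIdx a c p ν r.val.succPNat) =
        -∑ r₂ : Fin (Nc d (p - c)), (Pbar a c p ν)⁻¹ r r₂ *
          ∑ s ∈ Jfin a c p ν, bcoef a c (ν.toEquiv r₂.val.succPNat) (ν.toEquiv s) * v s := by
    set w : Fin (Nc d (p - c)) → ℂ := fun r => v (hIdx a c p ν r.val.succPNat) with hw
    set u : Fin (Nc d (p - c)) → ℂ := fun r =>
      ∑ s ∈ Jfin a c p ν, bcoef a c (ν.toEquiv r.val.succPNat) (ν.toEquiv s) * v s with hu
    have hPw : (Pbar a c p ν).mulVec w = -u := by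
      funext r
      have hr := hv r.val.succPNat (by rw [Nat.succPNat_coe]; exact r.isLt)
      rw [h.sum_range_Nc hpc fun l => bcoef a c (ν.toEquiv r.val.succPNat) (ν.toEquiv l) * v l]
        at hr
      exact eq_neg_of_add_eq_zero_right hr
    have hsolve : w = -(Pbar a c p ν)⁻¹.mulVec u := by
      rw [← Matrix.mulVec_neg, ← hPw, Matrix.mulVec_mulVec,
        Matrix.nonsing_inv_mul _ (h.isUnit_det_Pbar hpc), Matrix.one_mulVec]
    exact fun r => congrFun hsolve r
  refine ⟨hbar, fun i hi => ?_⟩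
  by_cases hr : ∃ r : Fin (Nc d (p - c)), hIdx a c p ν r.val.succPNat = i
  · have hval := hbar hr.choose
    rw [hr.choose_spec] at hval
    simp only [Mdec, dif_pos hr]
    rw [hval]
    simp only [neg_mul, Finset.sum_neg_distrib, Finset.sum_mul, Finset.mul_sum, mul_assoc]
    rw [Finset.sum_comm]
  · have hmem : i ∈ Jfin a c p ν := by
      simp only [Jfin, Finset.mem_image, Finset.mem_filter, Finset.mem_range]
      have hpred := PNat.natPred_add_one i
      refine ⟨i.natPred, ⟨by omega, ?_⟩, PNat.succPNat_natPred i⟩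
      rw [PNat.succPNat_natPred]
      rintro ⟨k, hk, hki⟩
      have hkpred := PNat.natPred_add_one k
      exact hr ⟨⟨k.natPred, by omega⟩, by simpa [PNat.succPNat_natPred] using hki⟩
    simp [Mdec, dif_neg hr, hmem]
end

section
/- Let t = ν(h(1)). Then |t| = c, the set of unrepresented multi-indices {ν(h(1)),…,ν(h(N(p−c)))} equals {t + r : r ∈ M(p−c)}, and the set of represented multi-indices {ν(s) : s ∈ j} equals {m ∈ M(p) : m_i < t_i for some i ∈ {1,…,d}}. In particular, {ν(s) : s ∈ j} is the union, over i ∈ {1,…,d} and s ∈ {0,…,t_i−1}, of the slices S_{i,s} = {m ∈ M(p) : m_i = s}, a union of exactly |t| = c slices. -/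
open scoped BigOperators

namespace GradedOrdering

variable {d : ℕ} (ν : GradedOrdering d)

theorem degree_mono {i j : ℕ+} (h : i ≤ j) : ∑ k, ν.toEquiv i k ≤ ∑ k, ν.toEquiv j k :=
  not_lt.1 fun hlt => (ν.graded j i hlt).not_ge h

/-- The first `N(t)` multi-indices of a graded ordering are those of degree at most `t`. -/
theorem le_Nc_iff_s14 {t : ℕ} {i : ℕ+} : (i : ℕ) ≤ Nc d t ↔ ∑ k, ν.toEquiv i k ≤ t := by
  constructor
  · intro h
    by_contra! hlt
    have hcard : (Mfin d t).card ≤ (Finset.Ico 1 i).card := by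
      refine Finset.card_le_card_of_injOn ν.toEquiv.symm (fun m hm => ?_)
        ν.toEquiv.symm.injective.injOn
      have hm' := mem_Mfin.1 (Finset.mem_coe.1 hm)
      refine Finset.mem_coe.2 (Finset.mem_Ico.2 ⟨one_le, ν.graded _ _ ?_⟩)
      rw [ν.toEquiv.apply_symm_apply]
      exact hm'.trans_lt hlt
    rw [PNat.card_Ico, PNat.one_coe] at hcard
    have := i.pos
    unfold Nc at h
    omega
  · intro h
    have hcard : (Finset.Icc 1 i).card ≤ (Mfin d t).card :=
      Finset.card_le_card_of_injOn ν.toEquiv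
        (fun j hj => Finset.mem_coe.2 (mem_Mfin.2
          ((ν.degree_mono (Finset.mem_Icc.1 (Finset.mem_coe.1 hj)).2).trans h)))
        ν.toEquiv.injective.injOn
    simpa [PNat.card_Icc, Nc] using hcard

theorem symm_add_le_symm_add {q r : Fin d → ℕ} (n : Fin d → ℕ)
    (h : ν.toEquiv.symm q ≤ ν.toEquiv.symm r) :
    ν.toEquiv.symm (n + q) ≤ ν.toEquiv.symm (n + r) := by
  rcases h.lt_or_eq with h | h
  · simpa [add_comm] using (ν.compat _ _ (ν.toEquiv.symm n) h).le
  · rw [ν.toEquiv.symm.injective h]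

end GradedOrdering

/-- The symbol `a` has a leading multi-index `t` of degree `c`, and `h(i)` is the position of
`ν(i) + t`. -/
theorem exists_leading_index {d p c : ℕ} (hpc : c ≤ p) (ν : GradedOrdering d)
    (a : (Fin d → ℕ) → ℂ) (ha : ∃ m ∈ Mfin d c, (∑ i, m i) = c ∧ a m ≠ 0) :
    ∃ t : Fin d → ℕ, ∑ k, t k = c ∧ ∀ i : ℕ+, (i : ℕ) ≤ Nc d (p - c) →
      ν.toEquiv (hIdx a c p ν i) = ν.toEquiv i + t := by
  classical
  obtain ⟨m₀, hm₀, hdeg, ham₀⟩ := ha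
  obtain ⟨t, ht, hmax⟩ := ((Mfin d c).filter fun m => a m ≠ 0).exists_max_image ν.toEquiv.symm
    ⟨m₀, Finset.mem_filter.2 ⟨hm₀, ham₀⟩⟩
  obtain ⟨htc, hat⟩ := Finset.mem_filter.1 ht
  have htdeg : ∑ k, t k = c := by
    refine (mem_Mfin.1 htc).antisymm ?_
    simpa [hdeg] using ν.degree_mono (hmax m₀ (Finset.mem_filter.2 ⟨hm₀, ham₀⟩))
  refine ⟨t, htdeg, fun i hi => ?_⟩
  have hgreatest : IsGreatest {l : ℕ | 0 < l ∧ l ≤ Nc d p ∧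
      bcoef a c (ν.toEquiv i) (ν.toEquiv l.toPNat') ≠ 0}
      (ν.toEquiv.symm (ν.toEquiv i + t) : ℕ+) := by
    refine ⟨⟨PNat.pos _, ?_, ?_⟩, ?_⟩
    · rw [ν.le_Nc_iff_s14] at hi ⊢
      simp only [Equiv.apply_symm_apply, Pi.add_apply, Finset.sum_add_distrib]
      omega
    · simpa [bcoef, htc] using hat
    · rintro l ⟨hl, -, hb⟩
      obtain ⟨l, rfl⟩ : ∃ l' : ℕ+, (l' : ℕ) = l := ⟨⟨l, hl⟩, rfl⟩
      rw [PNat.coe_toPNat', bcoef] at hb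
      split_ifs at hb with hle
      · have := ν.symm_add_le_symm_add (ν.toEquiv i)
          (hmax _ (Finset.mem_filter.2 ⟨hle.2, hb⟩))
        rw [add_tsub_cancel_of_le hle.1, Equiv.symm_apply_apply] at this
        exact this
      · exact absurd rfl hb
  rw [hIdx, hgreatest.csSup_eq, PNat.coe_toPNat', Equiv.apply_symm_apply]

theorem mem_Jfin {d p c : ℕ} {ν : GradedOrdering d} {a : (Fin d → ℕ) → ℂ} {s : ℕ+} :
    s ∈ Jfin a c p ν ↔ (s : ℕ) ≤ Nc d p ∧ s ∉ barSet a c p ν := by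
  simp only [Jfin, Finset.mem_image, Finset.mem_filter, Finset.mem_range]
  constructor
  · rintro ⟨l, ⟨hl, hb⟩, rfl⟩
    exact ⟨hl, hb⟩
  · rintro ⟨hs, hb⟩
    refine ⟨s.natPred, ⟨?_, ?_⟩, PNat.succPNat_natPred s⟩
    · have := PNat.natPred_add_one s
      omega
    · rwa [PNat.succPNat_natPred]

/-- Let `t = ν(h(1))`.  Then `|t| = c`; the set of unrepresented
multi-indices equals `{t + r : r ∈ M(p−c)}`; the set of represented multi-indices equals
`{m ∈ M(p) : m_i < t_i for some i}`; and in particular the represented multi-indices form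
the union over `i ∈ {1,…,d}` and `s ∈ {0,…,t_i−1}` of the slices
`S_{i,s} = {m ∈ M(p) : m_i = s}` — a union of exactly `|t| = c` slices. -/
theorem divide_multi_indices {d p c : ℕ} (hd : 1 ≤ d) (hc : 1 ≤ c) (hpc : c ≤ p)
    (ν : GradedOrdering d) (a : (Fin d → ℕ) → ℂ)
    (ha : ∃ m ∈ Mfin d c, (∑ i, m i) = c ∧ a m ≠ 0) :
    (∑ i, ν.toEquiv (hIdx a c p ν 1) i) = c
    ∧ {m : Fin d → ℕ | ∃ i : ℕ+, (i : ℕ) ≤ Nc d (p - c) ∧ ν.toEquiv (hIdx a c p ν i) = m}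
        = {m : Fin d → ℕ | ∃ r ∈ Mfin d (p - c), m = ν.toEquiv (hIdx a c p ν 1) + r}
    ∧ {m : Fin d → ℕ | ∃ s ∈ Jfin a c p ν, ν.toEquiv s = m}
        = {m : Fin d → ℕ | m ∈ Mfin d p ∧ ∃ i : Fin d, m i < ν.toEquiv (hIdx a c p ν 1) i}
    ∧ {m : Fin d → ℕ | ∃ s ∈ Jfin a c p ν, ν.toEquiv s = m}
        = ⋃ (i : Fin d), ⋃ (s : ℕ) (_ : s < ν.toEquiv (hIdx a c p ν 1) i),
            {m : Fin d → ℕ | m ∈ Mfin d p ∧ m i = s} := by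
  obtain ⟨t, htdeg, ht⟩ := exists_leading_index hpc ν a ha
  have hone : ν.toEquiv (hIdx a c p ν 1) = t := by
    rw [ht 1 (ν.le_Nc_iff_s14.2 (by simp [ν.map_one])), ν.map_one, zero_add]
  have hrep : {m : Fin d → ℕ | ∃ s ∈ Jfin a c p ν, ν.toEquiv s = m}
      = {m : Fin d → ℕ | m ∈ Mfin d p ∧ ∃ i : Fin d, m i < t i} := by
    ext m
    obtain ⟨s, rfl⟩ := ν.toEquiv.surjective m
    have hbar : s ∈ barSet a c p ν ↔ ∑ k, ν.toEquiv s k ≤ p ∧ t ≤ ν.toEquiv s := by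
      constructor
      · rintro ⟨i, hi, rfl⟩
        rw [ht i hi]
        rw [ν.le_Nc_iff_s14] at hi
        refine ⟨?_, le_add_self⟩
        simp only [Pi.add_apply, Finset.sum_add_distrib]
        omega
      · rintro ⟨hs, hle⟩
        obtain ⟨r, hr⟩ := exists_add_of_le hle
        have hi : ((ν.toEquiv.symm r : ℕ+) : ℕ) ≤ Nc d (p - c) := by
          rw [ν.le_Nc_iff_s14, Equiv.apply_symm_apply]
          simp only [hr, Pi.add_apply, Finset.sum_add_distrib] at hs
          omega
        refine ⟨_, hi, ν.toEquiv.injective ?_⟩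
        rw [ht _ hi, hr, Equiv.apply_symm_apply, add_comm]
    simp only [Set.mem_ofPred_eq, EmbeddingLike.apply_eq_iff_eq, exists_eq_right, mem_Jfin, hbar,
      ν.le_Nc_iff_s14, mem_Mfin, Pi.le_def, not_and, not_forall, not_le]
    exact and_congr_right fun h => ⟨fun h' => h' h, fun h' _ => h'⟩
  rw [hone, hrep]
  refine ⟨htdeg, ?_, rfl, ?_⟩
  · ext m
    constructor
    · rintro ⟨i, hi, rfl⟩
      exact ⟨ν.toEquiv i, mem_Mfin.2 (ν.le_Nc_iff_s14.1 hi), by rw [ht i hi, add_comm]⟩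
    · rintro ⟨r, hr, rfl⟩
      have hi : ((ν.toEquiv.symm r : ℕ+) : ℕ) ≤ Nc d (p - c) := by
        rw [ν.le_Nc_iff_s14, Equiv.apply_symm_apply]
        exact mem_Mfin.1 hr
      exact ⟨_, hi, by rw [ht _ hi, Equiv.apply_symm_apply, add_comm]⟩
  · ext m
    simp
end
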